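/- Let μ be a real rational function of k without poles in (−1,1), such that μ(k) ∈ [0,1) for all k ∈ (−1,1) and μ′(0) ≠ 0. If P₁, P₂, P₃ are real polynomials in k satisfying P₁(k)·K(k) + P₂(k)·E(k) + P₃(k)·Π(μ(k),k) = 0 for all k ∈ (−1,1), then P₁, P₂ and P₃ are identically zero. (Equivalently, K(k), E(k) and Π(μ(k),k) are linearly independent with respect to coefficients that are rational functions of k.) -/

import Mathlib

/-- Complete elliptic integral of the first kind. -/
noncomputable def Kc (k : ℝ) : ℝ :=
  ∫ z in (0:ℝ)..1, 1 / Real.sqrt ((1 - z ^ 2) * (1 - k ^ 2 * z ^ 2))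

/-- Complete elliptic integral of the second kind. -/
noncomputable def Ec (k : ℝ) : ℝ :=
  ∫ z in (0:ℝ)..1, Real.sqrt (1 - k ^ 2 * z ^ 2) / Real.sqrt (1 - z ^ 2)

/-- Complete elliptic integral of the third kind. -/
noncomputable def Pic (μ k : ℝ) : ℝ :=
  ∫ z in (0:ℝ)..1, 1 / ((1 - μ * z ^ 2) * Real.sqrt ((1 - z ^ 2) * (1 - k ^ 2 * z ^ 2)))

open Set Filter Topology MeasureTheory intervalIntegral

/-- Differentiation under the integral sign for an integrand with jointly continuous derivative. -/
lemma hasDerivAt_intervalIntegral_of_continuousOn {F F' : ℝ → ℝ → ℝ} {U : Set ℝ} {a b x₀ : ℝ}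
    (hU : IsOpen U) (hx₀ : x₀ ∈ U) (hF : ∀ x ∈ U, Continuous (F x))
    (hF' : ContinuousOn (fun p : ℝ × ℝ => F' p.1 p.2) (U ×ˢ univ))
    (hderiv : ∀ x ∈ U, ∀ t, HasDerivAt (fun y => F y t) (F' x t) x) :
    HasDerivAt (fun x => ∫ t in a..b, F x t) (∫ t in a..b, F' x₀ t) x₀ := by
  obtain ⟨ε, hε, hball⟩ := Metric.nhds_basis_closedBall.mem_iff.1 (hU.mem_nhds hx₀)
  have hcompact : IsCompact (Metric.closedBall x₀ ε ×ˢ uIcc a b) :=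
    (isCompact_closedBall x₀ ε).prod isCompact_uIcc
  obtain ⟨C, hC⟩ := hcompact.exists_bound_of_continuousOn
    (hF'.mono (prod_mono hball (subset_univ _)))
  have hF'x₀ : Continuous (F' x₀) := by
    rw [← continuousOn_univ]
    exact hF'.comp (f := fun t => (x₀, t)) (by fun_prop) (fun t _ => mk_mem_prod hx₀ (mem_univ t))
  refine (hasDerivAt_integral_of_dominated_loc_of_deriv_le (bound := fun _ => C)
    (Metric.closedBall_mem_nhds x₀ hε) ?_ ((hF x₀ hx₀).intervalIntegrable a b)
    hF'x₀.aestronglyMeasurable ?_ intervalIntegrable_const ?_).2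
  · filter_upwards [hU.mem_nhds hx₀] with x hx
    exact (hF x hx).aestronglyMeasurable
  · exact Eventually.of_forall fun t ht x hx => hC (x, t) ⟨hx, uIoc_subset_uIcc ht⟩
  · exact Eventually.of_forall fun t _ x hx => hderiv x (hball hx) t

/-- The substitution `z = sin θ` on the unit interval. -/
lemma integral_zero_one_eq_integral_sin (g : ℝ → ℝ) :
    ∫ z in (0:ℝ)..1, g z = ∫ θ in (0:ℝ)..(Real.pi / 2), Real.cos θ * g (Real.sin θ) := by
  have hpi := Real.pi_pos
  have himage : Real.sin '' Ioo 0 (Real.pi / 2) = Ioo 0 1 := by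
    ext z
    constructor
    · rintro ⟨θ, hθ, rfl⟩
      refine ⟨Real.sin_pos_of_pos_of_lt_pi hθ.1 (by linarith [hθ.2]), ?_⟩
      rw [← Real.sin_pi_div_two]
      exact Real.sin_lt_sin_of_lt_of_le_pi_div_two (by linarith [hθ.1]) le_rfl hθ.2
    · intro hz
      exact ⟨Real.arcsin z, ⟨Real.arcsin_pos.2 hz.1, Real.arcsin_lt_pi_div_two.2 hz.2⟩,
        Real.sin_arcsin (by linarith [hz.1]) hz.2.le⟩
  have hinj : InjOn Real.sin (Ioo 0 (Real.pi / 2)) :=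
    Real.injOn_sin.mono
      (Ioo_subset_Icc_self.trans (Icc_subset_Icc_left (by linarith)))
  rw [integral_of_le zero_le_one, integral_of_le (by positivity), integral_Ioc_eq_integral_Ioo,
    integral_Ioc_eq_integral_Ioo, ← himage,
    integral_image_eq_integral_abs_deriv_smul measurableSet_Ioo
      (fun θ _ => (Real.hasDerivAt_sin θ).hasDerivWithinAt) hinj]
  refine setIntegral_congr_fun measurableSet_Ioo fun θ hθ => ?_
  have hcos : 0 < Real.cos θ := Real.cos_pos_of_mem_Ioo ⟨by linarith [hθ.1], hθ.2⟩
  simp [abs_of_pos hcos]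

/-- The modular factor `√(1 - k² sin² θ)` of the trigonometric elliptic integrands. -/
noncomputable def ellipticDelta (k θ : ℝ) : ℝ := Real.sqrt (1 - k ^ 2 * Real.sin θ ^ 2)

lemma one_sub_mul_sin_sq_pos {m : ℝ} (hm : m < 1) (θ : ℝ) : 0 < 1 - m * Real.sin θ ^ 2 := by
  rcases le_total m 0 with h | h
  · nlinarith [sq_nonneg (Real.sin θ)]
  · nlinarith [Real.sin_sq_le_one θ]

lemma ellipticDelta_pos {k : ℝ} (hk : k ∈ Ioo (-1 : ℝ) 1) (θ : ℝ) : 0 < ellipticDelta k θ :=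
  Real.sqrt_pos.2 (one_sub_mul_sin_sq_pos (by nlinarith [hk.1, hk.2]) θ)

lemma ellipticDelta_sq {k : ℝ} (hk : k ∈ Ioo (-1 : ℝ) 1) (θ : ℝ) :
    ellipticDelta k θ ^ 2 = 1 - k ^ 2 * Real.sin θ ^ 2 :=
  Real.sq_sqrt (one_sub_mul_sin_sq_pos (by nlinarith [hk.1, hk.2]) θ).le

@[fun_prop]
lemma continuous_ellipticDelta : Continuous (fun p : ℝ × ℝ => ellipticDelta p.1 p.2) := by
  unfold ellipticDelta
  fun_prop

@[fun_prop]
lemma continuous_ellipticDelta_right (k : ℝ) : Continuous (ellipticDelta k) := by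
  unfold ellipticDelta
  fun_prop

lemma hasDerivAt_ellipticDelta_modulus {k : ℝ} (hk : k ∈ Ioo (-1 : ℝ) 1) (θ : ℝ) :
    HasDerivAt (fun x => ellipticDelta x θ) (-(k * Real.sin θ ^ 2) / ellipticDelta k θ) k := by
  have hpos := one_sub_mul_sin_sq_pos (m := k ^ 2) (by nlinarith [hk.1, hk.2]) θ
  have hinner : HasDerivAt (fun x : ℝ => 1 - x ^ 2 * Real.sin θ ^ 2)
      (-(2 * k * Real.sin θ ^ 2)) k := by
    simpa using ((hasDerivAt_pow 2 k).mul_const (Real.sin θ ^ 2)).const_sub 1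
  refine (hinner.sqrt hpos.ne').congr_deriv ?_
  have hΔ := (ellipticDelta_pos hk θ).ne'
  change _ / (2 * ellipticDelta k θ) = _
  field_simp

lemma hasDerivAt_ellipticDelta_angle {k : ℝ} (hk : k ∈ Ioo (-1 : ℝ) 1) (θ : ℝ) :
    HasDerivAt (ellipticDelta k)
      (-(k ^ 2 * Real.sin θ * Real.cos θ) / ellipticDelta k θ) θ := by
  have hpos := one_sub_mul_sin_sq_pos (m := k ^ 2) (by nlinarith [hk.1, hk.2]) θ
  have hinner : HasDerivAt (fun t : ℝ => 1 - k ^ 2 * Real.sin t ^ 2)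
      (-(k ^ 2 * (2 * Real.sin θ * Real.cos θ))) θ := by
    simpa using (((Real.hasDerivAt_sin θ).pow 2).const_mul (k ^ 2)).const_sub 1
  refine (hinner.sqrt hpos.ne').congr_deriv ?_
  have hΔ := (ellipticDelta_pos hk θ).ne'
  change _ / (2 * ellipticDelta k θ) = _
  field_simp

lemma Pic_eq_integral (μ k : ℝ) : Pic μ k =
    ∫ θ in (0:ℝ)..(Real.pi / 2), 1 / ((1 - μ * Real.sin θ ^ 2) * ellipticDelta k θ) := by
  rw [Pic, integral_zero_one_eq_integral_sin]
  rw [integral_of_le (by positivity), integral_of_le (by positivity), integral_Ioc_eq_integral_Ioo,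
    integral_Ioc_eq_integral_Ioo]
  refine setIntegral_congr_fun measurableSet_Ioo fun θ hθ => ?_
  have hcos : 0 < Real.cos θ :=
    Real.cos_pos_of_mem_Ioo ⟨by linarith [hθ.1, Real.pi_pos], hθ.2⟩
  have hsqrt : Real.sqrt ((1 - Real.sin θ ^ 2) * (1 - k ^ 2 * Real.sin θ ^ 2)) =
      Real.cos θ * ellipticDelta k θ := by
    rw [← Real.cos_sq', Real.sqrt_mul (sq_nonneg _), Real.sqrt_sq hcos.le, ellipticDelta]
  simp only [hsqrt]
  rw [mul_left_comm, mul_one_div, div_mul_eq_div_div, div_self hcos.ne']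

lemma Kc_eq_Pic_zero (k : ℝ) : Kc k = Pic 0 k := by
  simp [Kc, Pic]

lemma Kc_eq_integral (k : ℝ) : Kc k =
    ∫ θ in (0:ℝ)..(Real.pi / 2), 1 / ellipticDelta k θ := by
  simp [Kc_eq_Pic_zero, Pic_eq_integral]

lemma Ec_eq_integral (k : ℝ) : Ec k = ∫ θ in (0:ℝ)..(Real.pi / 2), ellipticDelta k θ := by
  rw [Ec, integral_zero_one_eq_integral_sin]
  rw [integral_of_le (by positivity), integral_of_le (by positivity), integral_Ioc_eq_integral_Ioo,
    integral_Ioc_eq_integral_Ioo]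
  refine setIntegral_congr_fun measurableSet_Ioo fun θ hθ => ?_
  have hcos : 0 < Real.cos θ :=
    Real.cos_pos_of_mem_Ioo ⟨by linarith [hθ.1, Real.pi_pos], hθ.2⟩
  simp only [← Real.cos_sq', Real.sqrt_sq hcos.le, ellipticDelta]
  exact mul_div_cancel₀ _ hcos.ne'

/-- The derivative of `Π(μ(k), k)` along a `C¹` parameter function, as an integral. -/
lemma hasDerivAt_Pic_comp {μ μ' : ℝ → ℝ} (hμ' : ContinuousOn μ' (Ioo (-1) 1))
    (hμ : ∀ x ∈ Ioo (-1 : ℝ) 1, HasDerivAt μ (μ' x) x) (hlt : ∀ x ∈ Ioo (-1 : ℝ) 1, μ x < 1)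
    {k : ℝ} (hk : k ∈ Ioo (-1 : ℝ) 1) :
    HasDerivAt (fun x => Pic (μ x) x) (∫ θ in (0:ℝ)..(Real.pi / 2),
      (μ' k * (Real.sin θ ^ 2 / ((1 - μ k * Real.sin θ ^ 2) ^ 2 * ellipticDelta k θ))
        + k * Real.sin θ ^ 2 / ((1 - μ k * Real.sin θ ^ 2) * ellipticDelta k θ ^ 3))) k := by
  have hμc : ContinuousOn μ (Ioo (-1) 1) := fun x hx => (hμ x hx).continuousAt.continuousWithinAt
  have hfst : MapsTo Prod.fst (Ioo (-1 : ℝ) 1 ×ˢ (univ : Set ℝ)) (Ioo (-1) 1) := fun p hp => hp.1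
  have hμ₂ := hμc.comp continuousOn_fst hfst
  have hμ'₂ := hμ'.comp continuousOn_fst hfst
  simp only [Function.comp_def] at hμ₂ hμ'₂
  simp only [Pic_eq_integral]
  refine hasDerivAt_intervalIntegral_of_continuousOn
    (F := fun x θ => 1 / ((1 - μ x * Real.sin θ ^ 2) * ellipticDelta x θ))
    (F' := fun x θ =>
      μ' x * (Real.sin θ ^ 2 / ((1 - μ x * Real.sin θ ^ 2) ^ 2 * ellipticDelta x θ))
        + x * Real.sin θ ^ 2 / ((1 - μ x * Real.sin θ ^ 2) * ellipticDelta x θ ^ 3))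
    isOpen_Ioo hk ?_ ?_ ?_
  · intro x hx
    refine Continuous.div (by fun_prop) (by fun_prop) fun θ => ?_
    exact (mul_pos (one_sub_mul_sin_sq_pos (hlt x hx) θ) (ellipticDelta_pos hx θ)).ne'
  · have hne : ∀ p ∈ Ioo (-1 : ℝ) 1 ×ˢ (univ : Set ℝ),
        0 < 1 - μ p.1 * Real.sin p.2 ^ 2 ∧ 0 < ellipticDelta p.1 p.2 := fun p hp =>
      ⟨one_sub_mul_sin_sq_pos (hlt _ hp.1) _, ellipticDelta_pos hp.1 _⟩
    refine ContinuousOn.add (hμ'₂.mul (ContinuousOn.div (by fun_prop) (by fun_prop) fun p hp => ?_))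
      (ContinuousOn.div (by fun_prop) (by fun_prop) fun p hp => ?_) <;>
    · obtain ⟨h₁, h₂⟩ := hne p hp
      positivity
  · intro x hx θ
    have h₁ := (one_sub_mul_sin_sq_pos (hlt x hx) θ).ne'
    have h₂ := (ellipticDelta_pos hx θ).ne'
    have hden := (((hμ x hx).mul_const (Real.sin θ ^ 2)).const_sub 1).fun_mul
      (hasDerivAt_ellipticDelta_modulus hx θ)
    simp only [one_div]
    refine (hden.fun_inv (mul_ne_zero h₁ h₂)).congr_deriv ?_
    field_simp
    ring

lemma hasDerivAt_Ec {k : ℝ} (hk : k ∈ Ioo (-1 : ℝ) 1) :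
    HasDerivAt Ec (∫ θ in (0:ℝ)..(Real.pi / 2),
      -(k * Real.sin θ ^ 2) / ellipticDelta k θ) k := by
  rw [show Ec = fun k => ∫ θ in (0:ℝ)..(Real.pi / 2), ellipticDelta k θ from
    funext Ec_eq_integral]
  refine hasDerivAt_intervalIntegral_of_continuousOn
    (F' := fun x θ => -(x * Real.sin θ ^ 2) / ellipticDelta x θ)
    isOpen_Ioo hk ?_ ?_ ?_
  · intro x hx
    fun_prop
  · exact ContinuousOn.div (by fun_prop) (by fun_prop) fun p hp => (ellipticDelta_pos hp.1 _).ne'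
  · exact fun x hx θ => hasDerivAt_ellipticDelta_modulus hx θ

lemma continuous_one_div_ellipticDelta {k : ℝ} (hk : k ∈ Ioo (-1 : ℝ) 1) :
    Continuous fun θ => 1 / ellipticDelta k θ :=
  continuous_const.div (by fun_prop) fun θ => (ellipticDelta_pos hk θ).ne'

lemma continuous_one_div_mul_ellipticDelta {μ k : ℝ} (hμ : μ < 1) (hk : k ∈ Ioo (-1 : ℝ) 1) :
    Continuous fun θ => 1 / ((1 - μ * Real.sin θ ^ 2) * ellipticDelta k θ) :=
  continuous_const.div (by fun_prop) fun θ =>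
    mul_ne_zero (one_sub_mul_sin_sq_pos hμ θ).ne' (ellipticDelta_pos hk θ).ne'

/-- The complete integral of a combination of the three elliptic integrands plus an exact
derivative whose primitive vanishes at both ends. -/
lemma integral_combination_add_deriv {μ k : ℝ} (hμ : μ < 1) (hk : k ∈ Ioo (-1 : ℝ) 1)
    (a b c : ℝ) {f H : ℝ → ℝ} (hf : Continuous f) (h₀ : H 0 = 0) (h₁ : H (Real.pi / 2) = 0)
    (hH : ∀ θ, HasDerivAt H (f θ - (a * (1 / ellipticDelta k θ) + b * ellipticDelta k θ
      + c * (1 / ((1 - μ * Real.sin θ ^ 2) * ellipticDelta k θ)))) θ) :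
    ∫ θ in (0:ℝ)..(Real.pi / 2), f θ = a * Kc k + b * Ec k + c * Pic μ k := by
  have hK := continuous_one_div_ellipticDelta hk
  have hP := continuous_one_div_mul_ellipticDelta hμ hk
  have hE := continuous_ellipticDelta_right k
  have hKE : Continuous fun θ => a * (1 / ellipticDelta k θ) + b * ellipticDelta k θ :=
    (hK.const_mul a).add (hE.const_mul b)
  have hsum : Continuous fun θ => a * (1 / ellipticDelta k θ) + b * ellipticDelta k θ
      + c * (1 / ((1 - μ * Real.sin θ ^ 2) * ellipticDelta k θ)) :=
    hKE.add (hP.const_mul c)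
  have hint := integral_eq_sub_of_hasDerivAt (a := 0) (b := Real.pi / 2) (fun θ _ => hH θ)
    ((hf.sub hsum).intervalIntegrable _ _)
  rw [h₀, h₁, sub_zero, intervalIntegral.integral_sub (hf.intervalIntegrable _ _)
      (hsum.intervalIntegrable _ _),
    intervalIntegral.integral_add (hKE.intervalIntegrable _ _)
      ((hP.const_mul c).intervalIntegrable _ _),
    intervalIntegral.integral_add ((hK.const_mul a).intervalIntegrable _ _)
      ((hE.const_mul b).intervalIntegrable _ _),
    intervalIntegral.integral_const_mul, intervalIntegral.integral_const_mul,
    intervalIntegral.integral_const_mul, ← Kc_eq_integral, ← Ec_eq_integral, ← Pic_eq_integral]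
    at hint
  linarith

/-- Reduction of the `μ`-derivative of the integrand of `Π`. -/
lemma integral_Pic_deriv_parameter {μ k : ℝ} (hμ : μ < 1) (hk : k ∈ Ioo (-1 : ℝ) 1) :
    2 * μ * (μ - k ^ 2) * (1 - μ) * (∫ θ in (0:ℝ)..(Real.pi / 2),
      Real.sin θ ^ 2 / ((1 - μ * Real.sin θ ^ 2) ^ 2 * ellipticDelta k θ)) =
    -(μ - k ^ 2) * Kc k + μ * Ec k + (μ ^ 2 - k ^ 2) * Pic μ k := by
  rw [← intervalIntegral.integral_const_mul]
  refine integral_combination_add_deriv hμ hk _ _ _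
    (H := fun θ => -μ ^ 2 * (Real.sin θ * Real.cos θ * ellipticDelta k θ
      / (1 - μ * Real.sin θ ^ 2))) ?_ (by simp) (by simp) ?_
  · exact continuous_const.mul (Continuous.div (by fun_prop) (by fun_prop) fun θ =>
      mul_ne_zero (pow_ne_zero 2 (one_sub_mul_sin_sq_pos hμ θ).ne') (ellipticDelta_pos hk θ).ne')
  · intro θ
    have h₁ := (one_sub_mul_sin_sq_pos hμ θ).ne'
    have h₂ := (ellipticDelta_pos hk θ).ne'
    have hΔ := ellipticDelta_sq hk θ
    have hcos := Real.cos_sq' θ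
    have hden := (((Real.hasDerivAt_sin θ).fun_pow 2).const_mul μ).const_sub 1
    have hnum := ((Real.hasDerivAt_sin θ).fun_mul (Real.hasDerivAt_cos θ)).fun_mul
      (hasDerivAt_ellipticDelta_angle hk θ)
    refine ((hnum.fun_div hden h₁).const_mul (-μ ^ 2)).congr_deriv ?_
    field_simp
    ring_nf
    simp only [hΔ, hcos]
    ring

/-- Reduction of the `k`-derivative of the integrand of `Π`. -/
lemma integral_Pic_deriv_modulus {μ k : ℝ} (hμ : μ < 1) (hk : k ∈ Ioo (-1 : ℝ) 1) :
    (μ - k ^ 2) * (1 - k ^ 2) * (∫ θ in (0:ℝ)..(Real.pi / 2),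
      k * Real.sin θ ^ 2 / ((1 - μ * Real.sin θ ^ 2) * ellipticDelta k θ ^ 3)) =
    -k * Ec k + k * (1 - k ^ 2) * Pic μ k := by
  rw [← intervalIntegral.integral_const_mul]
  rw [show -k * Ec k + k * (1 - k ^ 2) * Pic μ k =
    0 * Kc k + -k * Ec k + k * (1 - k ^ 2) * Pic μ k by ring]
  refine integral_combination_add_deriv hμ hk _ _ _
    (H := fun θ => k ^ 3 * (Real.sin θ * Real.cos θ / ellipticDelta k θ))
    ?_ (by simp) (by simp) ?_
  · exact continuous_const.mul (Continuous.div (by fun_prop) (by fun_prop) fun θ =>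
      mul_ne_zero (one_sub_mul_sin_sq_pos hμ θ).ne' (pow_ne_zero 3 (ellipticDelta_pos hk θ).ne'))
  · intro θ
    have h₁ := (one_sub_mul_sin_sq_pos hμ θ).ne'
    have h₂ := (ellipticDelta_pos hk θ).ne'
    have hΔ := ellipticDelta_sq hk θ
    have hcos := Real.cos_sq' θ
    have hnum := (Real.hasDerivAt_sin θ).fun_mul (Real.hasDerivAt_cos θ)
    refine ((hnum.fun_div (hasDerivAt_ellipticDelta_angle hk θ) h₂).const_mul
      (k ^ 3)).congr_deriv ?_
    have hΔ4 : ellipticDelta k θ ^ 4 = (1 - k ^ 2 * Real.sin θ ^ 2) ^ 2 := by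
      rw [← hΔ]; ring
    generalize hD : 1 - μ * Real.sin θ ^ 2 = D at h₁ ⊢
    field_simp
    rw [← hD]
    ring_nf
    simp only [hΔ, hcos, hΔ4]
    ring

/-- Total derivative of `Π(μ(k), k)`, with denominators cleared. -/
lemma exists_hasDerivAt_Pic_comp {μ μ' : ℝ → ℝ} (hμ' : ContinuousOn μ' (Ioo (-1) 1))
    (hμ : ∀ x ∈ Ioo (-1 : ℝ) 1, HasDerivAt μ (μ' x) x) (hlt : ∀ x ∈ Ioo (-1 : ℝ) 1, μ x < 1)
    {k : ℝ} (hk : k ∈ Ioo (-1 : ℝ) 1) :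
    ∃ d, HasDerivAt (fun x => Pic (μ x) x) d k ∧
      2 * μ k * (μ k - k ^ 2) * (1 - μ k) * (1 - k ^ 2) * d =
        -(1 - k ^ 2) * μ' k * (μ k - k ^ 2) * Kc k
        + ((1 - k ^ 2) * μ' k * μ k - 2 * k * μ k * (1 - μ k)) * Ec k
        + (1 - k ^ 2) * (μ' k * (μ k ^ 2 - k ^ 2) + 2 * k * μ k * (1 - μ k)) * Pic (μ k) k := by
  refine ⟨_, hasDerivAt_Pic_comp hμ' hμ hlt hk, ?_⟩
  have hpar := integral_Pic_deriv_parameter (hlt k hk) hk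
  have hmod := integral_Pic_deriv_modulus (hlt k hk) hk
  have h₁ : ∀ θ, 1 - μ k * Real.sin θ ^ 2 ≠ 0 := fun θ => (one_sub_mul_sin_sq_pos (hlt k hk) θ).ne'
  have h₂ : ∀ θ, ellipticDelta k θ ≠ 0 := fun θ => (ellipticDelta_pos hk θ).ne'
  rw [intervalIntegral.integral_add, intervalIntegral.integral_const_mul]
  · linear_combination (1 - k ^ 2) * μ' k * hpar + 2 * μ k * (1 - μ k) * hmod
  · refine (continuous_const.mul (Continuous.div (by fun_prop) (by fun_prop) fun θ => ?_)
      ).intervalIntegrable _ _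
    exact mul_ne_zero (pow_ne_zero 2 (h₁ θ)) (h₂ θ)
  · refine (Continuous.div (by fun_prop) (by fun_prop) fun θ => ?_).intervalIntegrable _ _
    exact mul_ne_zero (h₁ θ) (pow_ne_zero 3 (h₂ θ))

lemma exists_hasDerivAt_Kc {k : ℝ} (hk : k ∈ Ioo (-1 : ℝ) 1) :
    ∃ d, HasDerivAt Kc d k ∧ k * (1 - k ^ 2) * d = Ec k - (1 - k ^ 2) * Kc k := by
  have hderiv := hasDerivAt_Pic_comp (μ := fun _ => 0) (μ' := fun _ => 0) continuousOn_const
    (fun x _ => hasDerivAt_const x 0) (fun _ _ => one_pos) hk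
  simp only [← Kc_eq_Pic_zero, zero_mul, zero_add, sub_zero] at hderiv
  refine ⟨_, hderiv, ?_⟩
  have hmod := integral_Pic_deriv_modulus one_pos hk
  simp only [← Kc_eq_Pic_zero, zero_mul, zero_sub, sub_zero] at hmod
  rcases eq_or_ne k 0 with rfl | hne
  · simp [Kc_eq_integral, Ec_eq_integral, ellipticDelta]
  · refine mul_left_cancel₀ hne ?_
    linear_combination -hmod

lemma exists_hasDerivAt_Ec {k : ℝ} (hk : k ∈ Ioo (-1 : ℝ) 1) :
    ∃ d, HasDerivAt Ec d k ∧ k * d = Ec k - Kc k := by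
  refine ⟨_, hasDerivAt_Ec hk, ?_⟩
  rw [← intervalIntegral.integral_const_mul, Ec_eq_integral, Kc_eq_integral,
    ← intervalIntegral.integral_sub ((continuous_ellipticDelta_right k).intervalIntegrable _ _)
      ((continuous_one_div_ellipticDelta hk).intervalIntegrable _ _)]
  refine intervalIntegral.integral_congr fun θ _ => ?_
  have h₂ := (ellipticDelta_pos hk θ).ne'
  have hΔ := ellipticDelta_sq hk θ
  field_simp
  linear_combination -hΔ

lemma Kc_pos {k : ℝ} (hk : k ∈ Ioo (-1 : ℝ) 1) : 0 < Kc k := by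
  rw [Kc_eq_integral]
  exact intervalIntegral_pos_of_pos
    ((continuous_one_div_ellipticDelta hk).intervalIntegrable _ _)
    (fun θ => one_div_pos.2 (ellipticDelta_pos hk θ)) (by positivity)

lemma one_le_Ec {k : ℝ} (hk : k ∈ Ioo (-1 : ℝ) 1) : 1 ≤ Ec k := by
  have hcos : ∫ θ in (0:ℝ)..(Real.pi / 2), Real.cos θ = 1 := by simp
  rw [Ec_eq_integral, ← hcos]
  refine integral_mono_on (by positivity) (Real.continuous_cos.intervalIntegrable _ _)
    ((continuous_ellipticDelta_right k).intervalIntegrable _ _) fun θ _ => ?_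
  refine Real.le_sqrt_of_sq_le ?_
  rw [Real.cos_sq']
  nlinarith [sq_nonneg (Real.sin θ), hk.1, hk.2, mul_nonneg (sq_nonneg (Real.sin θ))
    (mul_pos (by linarith [hk.1] : 0 < 1 + k) (by linarith [hk.2] : 0 < 1 - k)).le]

lemma Ec_le_pi_div_two (k : ℝ) : Ec k ≤ Real.pi / 2 := by
  have hone : ∫ _ in (0:ℝ)..(Real.pi / 2), (1 : ℝ) = Real.pi / 2 := by simp
  rw [Ec_eq_integral]
  refine (integral_mono_on (by positivity)
    ((continuous_ellipticDelta_right k).intervalIntegrable _ _) intervalIntegrable_const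
    fun θ _ => ?_).trans_eq hone
  exact Real.sqrt_le_one.2 (by nlinarith [mul_self_nonneg (k * Real.sin θ)])

lemma sqrt_one_sub_mul_Kc_le {k : ℝ} (hk : k ∈ Ioo (0 : ℝ) 1) :
    Real.sqrt (1 - k) * Kc k ≤ Real.pi / 2 := by
  have hk' : k ∈ Ioo (-1 : ℝ) 1 := ⟨by linarith [hk.1], hk.2⟩
  have hone : ∫ _ in (0:ℝ)..(Real.pi / 2), (1 : ℝ) = Real.pi / 2 := by simp
  rw [Kc_eq_integral, ← intervalIntegral.integral_const_mul]
  refine (integral_mono_on (by positivity)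
    (((continuous_one_div_ellipticDelta hk').const_mul _).intervalIntegrable _ _)
    intervalIntegrable_const fun θ _ => ?_).trans_eq hone
  rw [mul_one_div, div_le_one (ellipticDelta_pos hk' θ)]
  refine Real.sqrt_le_sqrt ?_
  nlinarith [Real.sin_sq_le_one θ, hk.1, hk.2, sq_nonneg (Real.sin θ), sq_nonneg k]

lemma neg_log_le_Kc {k : ℝ} (hk : k ∈ Ioo (-1 : ℝ) 1) :
    -Real.log (Real.sqrt (1 - k ^ 2)) ≤ Kc k := by
  set κ := Real.sqrt (1 - k ^ 2) with hκ
  have hk2 : 0 < 1 - k ^ 2 := by nlinarith [hk.1, hk.2]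
  have hκpos : 0 < κ := Real.sqrt_pos.2 hk2
  have hκsq : κ ^ 2 = 1 - k ^ 2 := Real.sq_sqrt hk2.le
  have hderiv : ∀ θ ∈ uIcc 0 (Real.pi / 2),
      HasDerivAt (fun t => -Real.log (Real.pi / 2 + κ - t)) (1 / (Real.pi / 2 + κ - θ)) θ := by
    intro θ hθ
    rw [uIcc_of_le (by positivity)] at hθ
    have hne : Real.pi / 2 + κ - θ ≠ 0 := by linarith [hθ.2]
    refine (((hasDerivAt_id θ).const_sub (Real.pi / 2 + κ)).log hne).neg.congr_deriv ?_
    simp [neg_div]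
  have hcont : IntervalIntegrable (fun θ => 1 / (Real.pi / 2 + κ - θ)) volume 0
      (Real.pi / 2) := by
    refine ContinuousOn.intervalIntegrable (ContinuousOn.div (by fun_prop) (by fun_prop) ?_)
    intro θ hθ
    rw [uIcc_of_le (by positivity)] at hθ
    linarith [hθ.2]
  have hint := integral_eq_sub_of_hasDerivAt hderiv hcont
  have hlog : 0 ≤ Real.log (Real.pi / 2 + κ) :=
    Real.log_nonneg (by linarith [Real.pi_gt_three])
  calc -Real.log κ ≤ ∫ θ in (0:ℝ)..(Real.pi / 2), 1 / (Real.pi / 2 + κ - θ) := by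
        rw [hint]
        simp only [add_sub_cancel_left, sub_zero]
        linarith
    _ ≤ Kc k := by
        rw [Kc_eq_integral]
        refine integral_mono_on (by positivity) hcont
          ((continuous_one_div_ellipticDelta hk).intervalIntegrable _ _) fun θ hθ => ?_
        refine one_div_le_one_div_of_le (ellipticDelta_pos hk θ) ?_
        have hcos : Real.cos θ ≤ Real.pi / 2 - θ := by
          rw [← Real.sin_pi_div_two_sub]
          exact Real.sin_le (by linarith [hθ.2])
        have hcos0 : 0 ≤ Real.cos θ :=
          Real.cos_nonneg_of_mem_Icc ⟨by linarith [hθ.1, Real.pi_pos], hθ.2⟩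
        have hΔ : ellipticDelta k θ ≤ Real.cos θ + κ := by
          refine Real.sqrt_le_iff.2 ⟨by positivity, ?_⟩
          have hcs := Real.cos_sq' θ
          nlinarith [mul_nonneg hcos0 hκpos.le, mul_nonneg hk2.le (sq_nonneg (Real.cos θ))]
        linarith

lemma tendsto_Kc_atTop : Tendsto Kc (𝓝[<] 1) atTop := by
  have hIoo : ∀ᶠ k : ℝ in 𝓝[<] 1, k ∈ Ioo (-1 : ℝ) 1 := Ioo_mem_nhdsLT (by norm_num)
  have hsqrt : Tendsto (fun k : ℝ => Real.sqrt (1 - k ^ 2)) (𝓝[<] 1) (𝓝[>] 0) := by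
    refine tendsto_nhdsWithin_iff.2 ⟨?_, ?_⟩
    · have hc : Continuous fun k : ℝ => Real.sqrt (1 - k ^ 2) := by fun_prop
      simpa using (hc.tendsto 1).mono_left nhdsWithin_le_nhds
    · filter_upwards [hIoo] with k hk
      exact Real.sqrt_pos.2 (by nlinarith [hk.1, hk.2])
  refine tendsto_atTop_mono' _ ?_
    (tendsto_neg_atBot_atTop.comp (Real.tendsto_log_nhdsGT_zero.comp hsqrt))
  filter_upwards [hIoo] with k hk using neg_log_le_Kc hk

lemma tendsto_one_sub_mul_Kc : Tendsto (fun k => (1 - k) * Kc k) (𝓝[<] 1) (𝓝 0) := by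
  have hIoo : ∀ᶠ k : ℝ in 𝓝[<] 1, k ∈ Ioo (0 : ℝ) 1 := Ioo_mem_nhdsLT one_pos
  have hc : Continuous fun k : ℝ => Real.sqrt (1 - k) * (Real.pi / 2) := by fun_prop
  have hbound : Tendsto (fun k : ℝ => Real.sqrt (1 - k) * (Real.pi / 2)) (𝓝[<] 1) (𝓝 0) := by
    simpa using (hc.tendsto 1).mono_left nhdsWithin_le_nhds
  refine squeeze_zero' ?_ ?_ hbound
  · filter_upwards [hIoo] with k hk
    exact mul_nonneg (by linarith [hk.2]) (Kc_pos ⟨by linarith [hk.1], hk.2⟩).le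
  · filter_upwards [hIoo] with k hk
    nth_rewrite 1 [← Real.mul_self_sqrt (by linarith [hk.2] : 0 ≤ 1 - k)]
    rw [mul_assoc]
    exact mul_le_mul_of_nonneg_left (sqrt_one_sub_mul_Kc_le hk) (Real.sqrt_nonneg _)

namespace Polynomial

lemma eq_zero_of_forall_X_sub_C_pow_dvd {p : ℝ[X]} {a : ℝ} (h : ∀ n, (X - C a) ^ n ∣ p) :
    p = 0 := by
  by_contra hp
  have := (le_rootMultiplicity_iff hp).2 (h (p.rootMultiplicity a + 1))
  omega

lemma tendsto_eval_nhdsWithin (p : ℝ[X]) (a : ℝ) (s : Set ℝ) :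
    Tendsto (fun x => p.eval x) (𝓝[s] a) (𝓝 (p.eval a)) :=
  (p.continuous.tendsto a).mono_left nhdsWithin_le_nhds

lemma eval_one_eq_zero_of_Kc_Ec_relation {P Q : ℝ[X]}
    (h : ∀ k ∈ Ioo (0 : ℝ) 1, P.eval k * Kc k + Q.eval k * Ec k = 0) :
    P.eval 1 = 0 ∧ Q.eval 1 = 0 := by
  have hIoo : ∀ᶠ k : ℝ in 𝓝[<] 1, k ∈ Ioo (0 : ℝ) 1 := Ioo_mem_nhdsLT one_pos
  have hP : P.eval 1 = 0 := by
    refine tendsto_nhds_unique (P.tendsto_eval_nhdsWithin 1 (Iio 1)) ?_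
    have hlim := ((Q.tendsto_eval_nhdsWithin 1 (Iio 1)).norm.mul_const (Real.pi / 2)).mul
      tendsto_Kc_atTop.inv_tendsto_atTop
    rw [mul_zero] at hlim
    refine squeeze_zero_norm' ?_ hlim
    filter_upwards [hIoo] with k hk
    have hk' : k ∈ Ioo (-1 : ℝ) 1 := ⟨by linarith [hk.1], hk.2⟩
    have hK := Kc_pos hk'
    have hPk : P.eval k = -(Q.eval k * Ec k) * (Kc k)⁻¹ := by
      rw [← div_eq_mul_inv, eq_div_iff hK.ne']
      linarith [h k hk]
    rw [hPk, norm_mul, norm_neg, norm_mul, Pi.inv_apply, norm_inv, Real.norm_of_nonneg hK.le,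
      Real.norm_of_nonneg (zero_le_one.trans (one_le_Ec hk'))]
    gcongr
    exact Ec_le_pi_div_two k
  refine ⟨hP, ?_⟩
  obtain ⟨P', rfl⟩ := dvd_iff_isRoot.2 hP
  refine tendsto_nhds_unique (Q.tendsto_eval_nhdsWithin 1 (Iio 1)) ?_
  have hlim := (P'.tendsto_eval_nhdsWithin 1 (Iio 1)).norm.mul tendsto_one_sub_mul_Kc
  rw [mul_zero] at hlim
  refine squeeze_zero_norm' ?_ hlim
  filter_upwards [hIoo] with k hk
  have hk' : k ∈ Ioo (-1 : ℝ) 1 := ⟨by linarith [hk.1], hk.2⟩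
  have hE := one_le_Ec hk'
  have hrel : Q.eval k * Ec k = P'.eval k * ((1 - k) * Kc k) := by
    have := h k hk
    simp only [eval_mul, eval_sub, eval_X, eval_C] at this
    linarith
  calc ‖Q.eval k‖ ≤ ‖Q.eval k‖ * Ec k := le_mul_of_one_le_right (norm_nonneg _) hE
    _ = ‖Q.eval k * Ec k‖ := by rw [norm_mul, Real.norm_of_nonneg (zero_le_one.trans hE)]
    _ = ‖P'.eval k‖ * ((1 - k) * Kc k) := by
      rw [hrel, norm_mul, Real.norm_of_nonneg
        (mul_nonneg (by linarith [hk.2] : 0 ≤ 1 - k) (Kc_pos hk').le)]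

/-- `K` and `E` are linearly independent over polynomials. -/
lemma eq_zero_of_Kc_Ec_relation {P Q : ℝ[X]}
    (h : ∀ k ∈ Ioo (0 : ℝ) 1, P.eval k * Kc k + Q.eval k * Ec k = 0) : P = 0 ∧ Q = 0 := by
  have hdvd : ∀ (n : ℕ) (P Q : ℝ[X]),
      (∀ k ∈ Ioo (0 : ℝ) 1, P.eval k * Kc k + Q.eval k * Ec k = 0) →
      (X - C 1) ^ n ∣ P ∧ (X - C 1) ^ n ∣ Q := by
    intro n
    induction n with
    | zero => simp
    | succ n ih =>
      intro P Q h
      obtain ⟨hP, hQ⟩ := eval_one_eq_zero_of_Kc_Ec_relation h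
      obtain ⟨P', rfl⟩ := dvd_iff_isRoot.2 hP
      obtain ⟨Q', rfl⟩ := dvd_iff_isRoot.2 hQ
      have h' := ih P' Q' fun k hk => by
        have hne : k - 1 ≠ 0 := by linarith [hk.2]
        refine mul_left_cancel₀ hne ?_
        have := h k hk
        simp only [eval_mul, eval_sub, eval_X, eval_C] at this
        linarith
      simp only [pow_succ']
      exact ⟨mul_dvd_mul_left _ h'.1, mul_dvd_mul_left _ h'.2⟩
  exact ⟨eq_zero_of_forall_X_sub_C_pow_dvd fun n => (hdvd n P Q h).1,
    eq_zero_of_forall_X_sub_C_pow_dvd fun n => (hdvd n P Q h).2⟩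

lemma X_mul_derivative_X_pow_mul (n : ℕ) (V : ℝ[X]) :
    X * derivative (X ^ n * V) = X ^ n * ((n : ℝ[X]) * V + X * derivative V) := by
  cases n with
  | zero => simp
  | succ n =>
    simp only [derivative_mul, derivative_X_pow, map_natCast, Nat.add_sub_cancel]
    ring

/-- Differentiating a relation among `K`, `E` and a solution `f` of a first-order linear equation
with inhomogeneity in the span of `K` and `E`, and eliminating `f`. -/
lemma relation_of_Kc_Ec_relation {f : ℝ → ℝ} {D α β γ P₁ P₂ P₃ : ℝ[X]}
    (hf : ∀ k ∈ Ioo (0 : ℝ) 1, ∃ d, HasDerivAt f d k ∧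
      D.eval k * d = γ.eval k * Kc k + β.eval k * Ec k + α.eval k * f k)
    (h : ∀ k ∈ Ioo (0 : ℝ) 1, P₁.eval k * Kc k + P₂.eval k * Ec k + P₃.eval k * f k = 0) :
    P₃ * (D * (1 - X ^ 2) * (X * derivative P₁ - P₁ - P₂) + X * (1 - X ^ 2) * P₃ * γ) =
      (1 - X ^ 2) * (D * (X * derivative P₃) + X * P₃ * α) * P₁ := by
  refine sub_eq_zero.1 (eq_zero_of_Kc_Ec_relation
    (Q := P₃ * (D * (X * (1 - X ^ 2) * derivative P₂ + P₁ + (1 - X ^ 2) * P₂)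
      + X * (1 - X ^ 2) * P₃ * β) - (1 - X ^ 2) * (D * (X * derivative P₃) + X * P₃ * α) * P₂)
    fun k hk => ?_).1
  have hk' : k ∈ Ioo (-1 : ℝ) 1 := ⟨by linarith [hk.1], hk.2⟩
  obtain ⟨dK, hdK, hK⟩ := exists_hasDerivAt_Kc hk'
  obtain ⟨dE, hdE, hE⟩ := exists_hasDerivAt_Ec hk'
  obtain ⟨d, hd, hfd⟩ := hf k hk
  have hsum := (((P₁.hasDerivAt k).fun_mul hdK).fun_add ((P₂.hasDerivAt k).fun_mul hdE)).fun_add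
    ((P₃.hasDerivAt k).fun_mul hd)
  have hzero : (fun x => P₁.eval x * Kc x + P₂.eval x * Ec x + P₃.eval x * f x) =ᶠ[𝓝 k]
      fun _ => 0 := by
    filter_upwards [isOpen_Ioo.mem_nhds hk] with x hx using h x hx
  have hdiff := hsum.unique ((hasDerivAt_const k (0 : ℝ)).congr_of_eventuallyEq hzero)
  have hrel := h k hk
  simp only [eval_sub, eval_mul, eval_add, eval_X, eval_one, eval_pow]
  linear_combination
    P₃.eval k * k * (1 - k ^ 2) * D.eval k * hdiff
    - P₃.eval k * D.eval k * P₁.eval k * hK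
    - P₃.eval k * D.eval k * (1 - k ^ 2) * P₂.eval k * hE
    - P₃.eval k ^ 2 * k * (1 - k ^ 2) * hfd
    - k * (1 - k ^ 2) * (D.eval k * (derivative P₃).eval k + P₃.eval k * α.eval k) * hrel

lemma eval_zero_eq_zero_of_Kc_Ec_relation {f : ℝ → ℝ} {D α β γ P₁ P₂ P₃ : ℝ[X]}
    (hf : ∀ k ∈ Ioo (0 : ℝ) 1, ∃ d, HasDerivAt f d k ∧
      D.eval k * d = γ.eval k * Kc k + β.eval k * Ec k + α.eval k * f k)
    (hD : D.eval 0 ≠ 0) (hcont : ContinuousAt f 0) (hf₀ : f 0 ≠ 0) (hP₃ : P₃ ≠ 0)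
    (h : ∀ k ∈ Ioo (0 : ℝ) 1, P₁.eval k * Kc k + P₂.eval k * Ec k + P₃.eval k * f k = 0) :
    P₁.eval 0 = 0 ∧ P₂.eval 0 = 0 ∧ P₃.eval 0 = 0 := by
  have hvalue : (P₁.eval 0 + P₂.eval 0) * (Real.pi / 2) + P₃.eval 0 * f 0 = 0 := by
    have h₀ : (0 : ℝ) ∈ Ioo (-1 : ℝ) 1 := by norm_num
    obtain ⟨_, hdK, -⟩ := exists_hasDerivAt_Kc h₀
    obtain ⟨_, hdE, -⟩ := exists_hasDerivAt_Ec h₀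
    have hlim : ContinuousAt
        (fun k => P₁.eval k * Kc k + P₂.eval k * Ec k + P₃.eval k * f k) 0 :=
      ((P₁.continuous.continuousAt.mul hdK.continuousAt).add
        (P₂.continuous.continuousAt.mul hdE.continuousAt)).add
        (P₃.continuous.continuousAt.mul hcont)
    have hzero : (fun _ => (0 : ℝ)) =ᶠ[𝓝[>] 0]
        fun k => P₁.eval k * Kc k + P₂.eval k * Ec k + P₃.eval k * f k := by
      filter_upwards [Ioo_mem_nhdsGT (zero_lt_one' ℝ)] with k hk using (h k hk).symm
    have := tendsto_nhds_unique (hlim.tendsto.mono_left nhdsWithin_le_nhds)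
      (tendsto_const_nhds.congr' hzero)
    have hK₀ : Kc 0 = Real.pi / 2 := by simp [Kc_eq_integral, ellipticDelta]
    have hE₀ : Ec 0 = Real.pi / 2 := by simp [Ec_eq_integral, ellipticDelta]
    rw [hK₀, hE₀] at this
    linarith
  have hrel := relation_of_Kc_Ec_relation hf h
  obtain ⟨V, hV, hndvd⟩ := exists_eq_pow_rootMultiplicity_mul_and_not_dvd P₃ hP₃ 0
  generalize P₃.rootMultiplicity 0 = n at hV
  rw [dvd_iff_isRoot] at hndvd
  rw [map_zero, sub_zero] at hV
  rw [hV, X_mul_derivative_X_pow_mul] at hrel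
  have hrel' : V * (D * (1 - X ^ 2) * (X * derivative P₁ - P₁ - P₂)
      + X * (1 - X ^ 2) * (X ^ n * V) * γ) =
      (1 - X ^ 2) * (D * ((n : ℝ[X]) * V + X * derivative V) + X * V * α) * P₁ := by
    refine mul_left_cancel₀ (pow_ne_zero n (X_ne_zero (R := ℝ))) ?_
    linear_combination hrel
  have hindicial : P₁.eval 0 + P₂.eval 0 = -(n * P₁.eval 0) := by
    have := congrArg (eval 0) hrel'
    simp only [eval_mul, eval_add, eval_sub, eval_X, eval_one, eval_pow, eval_natCast] at this
    refine mul_left_cancel₀ (mul_ne_zero hndvd hD) ?_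
    linear_combination -this
  have hpi : Real.pi / 2 ≠ 0 := by positivity
  have hP₃eval : P₃.eval 0 = 0 ^ n * V.eval 0 := by simp [hV]
  rcases Nat.eq_zero_or_pos n with rfl | hn
  · rw [hP₃eval, hindicial] at hvalue
    simp only [Nat.cast_zero, zero_mul, neg_zero, pow_zero, one_mul, zero_add] at hvalue
    exact absurd hvalue (mul_ne_zero hndvd hf₀)
  · rw [zero_pow hn.ne', zero_mul] at hP₃eval
    have hsum : P₁.eval 0 + P₂.eval 0 = 0 := by
      rw [hP₃eval, zero_mul, add_zero] at hvalue
      exact (mul_eq_zero.1 hvalue).resolve_right hpi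
    have hP₁ : P₁.eval 0 = 0 := by
      rw [hsum, eq_comm, neg_eq_zero] at hindicial
      exact (mul_eq_zero.1 hindicial).resolve_left (Nat.cast_ne_zero.2 hn.ne')
    exact ⟨hP₁, by linarith, hP₃eval⟩

/-- `K`, `E` and `f` are linearly independent over polynomials when `f` solves a first-order linear
equation, regular at `0`, with inhomogeneity in the span of `K` and `E`, and `f 0 ≠ 0`. -/
lemma eq_zero_of_Kc_Ec_solution_relation {f : ℝ → ℝ} {D α β γ P₁ P₂ P₃ : ℝ[X]}
    (hf : ∀ k ∈ Ioo (0 : ℝ) 1, ∃ d, HasDerivAt f d k ∧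
      D.eval k * d = γ.eval k * Kc k + β.eval k * Ec k + α.eval k * f k)
    (hD : D.eval 0 ≠ 0) (hcont : ContinuousAt f 0) (hf₀ : f 0 ≠ 0)
    (h : ∀ k ∈ Ioo (0 : ℝ) 1, P₁.eval k * Kc k + P₂.eval k * Ec k + P₃.eval k * f k = 0) :
    P₁ = 0 ∧ P₂ = 0 ∧ P₃ = 0 := by
  have hdvd : ∀ (n : ℕ) (P₁ P₂ P₃ : ℝ[X]),
      (∀ k ∈ Ioo (0 : ℝ) 1, P₁.eval k * Kc k + P₂.eval k * Ec k + P₃.eval k * f k = 0) →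
      (X - C 0) ^ n ∣ P₃ := by
    intro n
    induction n with
    | zero => simp
    | succ n ih =>
      intro P₁ P₂ P₃ h
      rcases eq_or_ne P₃ 0 with rfl | hP₃
      · exact dvd_zero _
      obtain ⟨h₁, h₂, h₃⟩ := eval_zero_eq_zero_of_Kc_Ec_relation hf hD hcont hf₀ hP₃ h
      obtain ⟨Q₁, rfl⟩ := dvd_iff_isRoot.2 h₁
      obtain ⟨Q₂, rfl⟩ := dvd_iff_isRoot.2 h₂
      obtain ⟨Q₃, rfl⟩ := dvd_iff_isRoot.2 h₃
      rw [pow_succ']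
      refine mul_dvd_mul_left _ (ih Q₁ Q₂ Q₃ fun k hk => ?_)
      refine mul_left_cancel₀ hk.1.ne' ?_
      have := h k hk
      simp only [eval_mul, eval_sub, eval_X, eval_C] at this
      linarith
  have hP₃ := eq_zero_of_forall_X_sub_C_pow_dvd fun n => hdvd n P₁ P₂ P₃ h
  have hKE := eq_zero_of_Kc_Ec_relation (P := P₁) (Q := P₂) fun k hk => by
    simpa [hP₃] using h k hk
  exact ⟨hKE.1, hKE.2, hP₃⟩

end Polynomial

lemma Pic_pos {μ k : ℝ} (hμ : μ < 1) (hk : k ∈ Ioo (-1 : ℝ) 1) : 0 < Pic μ k := by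
  rw [Pic_eq_integral]
  exact intervalIntegral_pos_of_pos
    ((continuous_one_div_mul_ellipticDelta hμ hk).intervalIntegrable _ _)
    (fun θ => one_div_pos.2 (mul_pos (one_sub_mul_sin_sq_pos hμ θ) (ellipticDelta_pos hk θ)))
    (by positivity)

/-- for a rational parameter function `μ = A/B` without poles in `(-1,1)`,
taking values in `[0,1)` and with `μ'(0) ≠ 0`, the functions `K(k)`, `E(k)` and
`Π(μ(k),k)` are linearly independent over polynomial (equivalently, rational)
coefficients in `k`. -/
theorem complete_integrals_linear_independent_rational_mu
    (A B : Polynomial ℝ)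
    (hB : ∀ k ∈ Set.Ioo (-1 : ℝ) 1, B.eval k ≠ 0)
    (hrange : ∀ k ∈ Set.Ioo (-1 : ℝ) 1, A.eval k / B.eval k ∈ Set.Ico (0 : ℝ) 1)
    (hμ' : deriv (fun k : ℝ => A.eval k / B.eval k) 0 ≠ 0)
    (P₁ P₂ P₃ : Polynomial ℝ)
    (h : ∀ k ∈ Set.Ioo (-1 : ℝ) 1,
      P₁.eval k * Kc k + P₂.eval k * Ec k
        + P₃.eval k * Pic (A.eval k / B.eval k) k = 0) :
    P₁ = 0 ∧ P₂ = 0 ∧ P₃ = 0 := by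
  set μ : ℝ → ℝ := fun k => A.eval k / B.eval k with hμdef
  set N : Polynomial ℝ := A.derivative * B - A * B.derivative
  set μ' : ℝ → ℝ := fun k => N.eval k / B.eval k ^ 2 with hμ'def
  have h₀ : (0 : ℝ) ∈ Ioo (-1 : ℝ) 1 := by norm_num
  have hderiv : ∀ k ∈ Ioo (-1 : ℝ) 1, HasDerivAt μ (μ' k) k := by
    intro k hk
    refine ((A.hasDerivAt k).fun_div (B.hasDerivAt k) (hB k hk)).congr_deriv ?_
    simp [hμ'def, N]
  have hμ'cont : ContinuousOn μ' (Ioo (-1) 1) :=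
    N.continuous.continuousOn.div (B.continuous.pow 2).continuousOn
      fun k hk => pow_ne_zero 2 (hB k hk)
  have hlt : ∀ k ∈ Ioo (-1 : ℝ) 1, μ k < 1 := fun k hk => (hrange k hk).2
  have hμ₀ : A.eval 0 ≠ 0 := by
    intro hA
    refine hμ' (IsLocalMin.deriv_eq_zero ?_)
    filter_upwards [isOpen_Ioo.mem_nhds h₀] with k hk
    simpa [hμdef, hA] using (hrange k hk).1
  have hB₀ := hB 0 h₀
  have hBA₀ : B.eval 0 - A.eval 0 ≠ 0 := by
    intro hBA
    have := hlt 0 h₀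
    simp [hμdef, ← sub_eq_zero.1 hBA, div_self hB₀] at this
  obtain ⟨_, hPd₀, -⟩ := exists_hasDerivAt_Pic_comp hμ'cont hderiv hlt h₀
  refine Polynomial.eq_zero_of_Kc_Ec_solution_relation (f := fun k => Pic (μ k) k)
    (D := 2 * A * (A - Polynomial.X ^ 2 * B) * (B - A) * (1 - Polynomial.X ^ 2) * B)
    (γ := -(1 - Polynomial.X ^ 2) * N * (A - Polynomial.X ^ 2 * B) * B)
    (β := (1 - Polynomial.X ^ 2) * N * A * B - 2 * Polynomial.X * A * (B - A) * B ^ 2)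
    (α := (1 - Polynomial.X ^ 2) *
      (N * (A ^ 2 - Polynomial.X ^ 2 * B ^ 2) + 2 * Polynomial.X * A * (B - A) * B ^ 2))
    ?_ ?_ hPd₀.continuousAt (Pic_pos (hlt 0 h₀) h₀).ne' ?_
  · intro k hk
    have hk' : k ∈ Ioo (-1 : ℝ) 1 := ⟨by linarith [hk.1], hk.2⟩
    obtain ⟨d, hd, heq⟩ := exists_hasDerivAt_Pic_comp hμ'cont hderiv hlt hk'
    refine ⟨d, hd, ?_⟩
    have hBk := hB k hk'
    have hAμ : A.eval k = μ k * B.eval k := by simp [hμdef, hBk]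
    have hNμ : N.eval k = μ' k * B.eval k ^ 2 := by simp [hμ'def, hBk]
    simp only [Polynomial.eval_mul, Polynomial.eval_sub, Polynomial.eval_add, Polynomial.eval_neg,
      Polynomial.eval_pow, Polynomial.eval_X, Polynomial.eval_one, Polynomial.eval_ofNat, hAμ, hNμ]
    linear_combination B.eval k ^ 4 * heq
  · simp [hμ₀, hB₀, hBA₀]
  · exact fun k hk => h k ⟨by linarith [hk.1], hk.2⟩
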